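/- Let Y be a real Hilbert space, A : ℓ² → Y a continuous linear operator, y ∈ Y, and α > 0. Let {q_k} satisfy 1 < q_k ≤ 2 for all k, q_k → 1 as k → ∞, and assume there exists a natural number N > 1 with ∑_k N^{−1/(q_k−1)} < ∞ (so that ℓ^{q_k} = ℓ¹). Then the Tikhonov functional x ↦ (1/2)‖Ax − y‖²_Y + α ∑_k |x_k|^{q_k} has a unique minimizer x_α over the set of sequences x ∈ ℓ² with ∑_k |x_k|^{q_k} < ∞ (equivalently, over ℓ¹); moreover, the minimizer satisfies ∑_k |(x_α)_k|^{2(q_k−1)} < ∞. -/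

import Mathlib

open Filter Topology

/-- A decreasing sequence of nonempty closed convex subsets of a Hilbert space, uniformly bounded,
has a common point. -/
theorem exists_forall_mem_of_antitone_convex {H : Type*} [NormedAddCommGroup H]
    [InnerProductSpace ℝ H] [CompleteSpace H] {C : ℕ → Set H} (hanti : Antitone C)
    (hne : ∀ n, (C n).Nonempty) (hclosed : ∀ n, IsClosed (C n)) (hconv : ∀ n, Convex ℝ (C n))
    {R : ℝ} (hR : ∀ x ∈ C 0, ‖x‖ ≤ R) : ∃ x, ∀ n, x ∈ C n := by
  choose p hpmem hp using fun n =>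
    exists_norm_eq_iInf_of_complete_convex (hne n) (hclosed n).isComplete (hconv n) (0 : H)
  have hmem : ∀ {n m}, n ≤ m → p m ∈ C n := fun h => hanti h (hpmem _)
  have hkey : ∀ n m, n ≤ m → ‖p m - p n‖ ^ 2 ≤ ‖p m‖ ^ 2 - ‖p n‖ ^ 2 := by
    intro n m h
    have h1 := (norm_eq_iInf_iff_real_inner_le_zero (hconv n) (hpmem n)).1 (hp n) (p m) (hmem h)
    have h2 := norm_add_sq_real (p n) (p m - p n)
    rw [add_sub_cancel] at h2
    rw [zero_sub, inner_neg_left] at h1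
    linarith
  have hmono : Monotone fun n => ‖p n‖ ^ 2 := fun n m h => by
    have := hkey n m h
    have := sq_nonneg ‖p m - p n‖
    simp only
    linarith
  have hbdd : BddAbove (Set.range fun n => ‖p n‖ ^ 2) := by
    refine ⟨R ^ 2, ?_⟩
    rintro _ ⟨n, rfl⟩
    exact pow_le_pow_left₀ (norm_nonneg _) (hR _ (hmem (Nat.zero_le n))) 2
  have hlim := tendsto_atTop_ciSup hmono hbdd
  set L := ⨆ n, ‖p n‖ ^ 2
  have hcauchy : CauchySeq p := by
    refine cauchySeq_of_le_tendsto_0' (fun n => √(L - ‖p n‖ ^ 2)) ?_ ?_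
    · intro n m h
      rw [dist_comm, dist_eq_norm]
      refine Real.le_sqrt_of_sq_le ((hkey n m h).trans ?_)
      have := le_ciSup hbdd m
      linarith
    · have := (Real.continuous_sqrt.tendsto _).comp (hlim.const_sub L)
      simpa [Function.comp_def] using this
  obtain ⟨x, hx⟩ := cauchySeq_tendsto_of_complete hcauchy
  refine ⟨x, fun n => (hclosed n).mem_of_tendsto hx ?_⟩
  filter_upwards [eventually_ge_atTop n] with m hm using hmem hm

theorem strictConvexOn_abs_rpow {p : ℝ} (hp : 1 < p) :
    StrictConvexOn ℝ Set.univ fun x : ℝ => |x| ^ p := by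
  refine ⟨convex_univ, fun a _ b _ hab s t hs ht hst => ?_⟩
  have hp0 : 0 < p := by linarith
  have hle : |s • a + t • b| ≤ s * |a| + t * |b| := by
    refine (abs_add_le _ _).trans_eq ?_
    simp [abs_mul, abs_of_pos hs, abs_of_pos ht]
  by_cases h : |a| = |b|
  · have hba : a = -b := (abs_eq_abs.1 h).resolve_left hab
    have hb : 0 < |b| := abs_pos.2 fun h0 => hab (by simp [hba, h0])
    have hlt : |s • a + t • b| < |b| := by
      have : s • a + t • b = (t - s) * b := by simp only [smul_eq_mul, hba]; ring
      rw [this, abs_mul]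
      have : |t - s| < 1 := by rw [abs_lt]; constructor <;> linarith
      nlinarith
    calc |s • a + t • b| ^ p < |b| ^ p := Real.rpow_lt_rpow (abs_nonneg _) hlt hp0
      _ = s • |a| ^ p + t • |b| ^ p := by rw [h, ← add_smul, hst, one_smul]
  · exact (Real.rpow_le_rpow (abs_nonneg _) hle hp0.le).trans_lt
      ((strictConvexOn_rpow hp).2 (abs_nonneg a) (abs_nonneg b) h hs ht hst)

section Tikhonov

variable {Y : Type*} [NormedAddCommGroup Y] [InnerProductSpace ℝ Y]

/-- The squared residual `x ↦ ½‖Ax − y‖²` is convex. -/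
theorem convexOn_half_sq_norm_sub {E : Type*} [NormedAddCommGroup E] [NormedSpace ℝ E]
    (A : E →L[ℝ] Y) (y : Y) : ConvexOn ℝ Set.univ fun x => (1 / 2) * ‖A x - y‖ ^ 2 := by
  have h : ConvexOn ℝ Set.univ fun x => ‖A x - y‖ := by
    refine ⟨convex_univ, fun x _ z _ s t hs ht hst => ?_⟩
    have : A (s • x + t • z) - y = s • (A x - y) + t • (A z - y) := by
      have hy : y = s • y + t • y := by rw [← add_smul, hst, one_smul]
      simp only [map_add, map_smul, smul_sub]
      nth_rewrite 1 [hy]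
      abel
    simp only [this]
    refine (norm_add_le _ _).trans_eq ?_
    simp [norm_smul, abs_of_nonneg hs, abs_of_nonneg ht]
  exact (h.pow (fun _ _ => norm_nonneg _) 2).smul (by norm_num)

/-- The Tikhonov functional with variable exponents `q`. -/
noncomputable def tikhonov (A : lp (fun _ : ℕ => ℝ) 2 →L[ℝ] Y) (y : Y) (α : ℝ) (q : ℕ → ℝ)
    (x : lp (fun _ : ℕ => ℝ) 2) : ℝ :=
  (1 / 2) * ‖A x - y‖ ^ 2 + α * ∑' k, |x k| ^ q k

/-- The sublevel set of the Tikhonov functional at level `c`, described by partial sums. -/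
def tikhonovSublevel (A : lp (fun _ : ℕ => ℝ) 2 →L[ℝ] Y) (y : Y) (α : ℝ) (q : ℕ → ℝ) (c : ℝ) :
    Set (lp (fun _ : ℕ => ℝ) 2) :=
  {x | ∀ s : Finset ℕ, (1 / 2) * ‖A x - y‖ ^ 2 + α * ∑ k ∈ s, |x k| ^ q k ≤ c}

variable (A : lp (fun _ : ℕ => ℝ) 2 →L[ℝ] Y) (y : Y) {α : ℝ} {q : ℕ → ℝ}

theorem mem_tikhonovSublevel_iff (hα : 0 < α) {c : ℝ} {x : lp (fun _ : ℕ => ℝ) 2} :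
    x ∈ tikhonovSublevel A y α q c ↔
      (Summable fun k => |x k| ^ q k) ∧ tikhonov A y α q x ≤ c := by
  have h0 : ∀ k, 0 ≤ |x k| ^ q k := fun k => by positivity
  constructor
  · intro h
    have hs : ∀ s : Finset ℕ, ∑ k ∈ s, |x k| ^ q k ≤ (c - (1 / 2) * ‖A x - y‖ ^ 2) / α := by
      intro s
      rw [le_div_iff₀ hα]
      linarith [h s]
    refine ⟨summable_of_sum_le h0 hs, ?_⟩
    have := Real.tsum_le_of_sum_le h0 hs
    rw [le_div_iff₀ hα] at this
    unfold tikhonov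
    linarith
  · rintro ⟨hs, hc⟩ s
    refine le_trans ?_ hc
    unfold tikhonov
    gcongr
    exact hs.sum_le_tsum s fun k _ => h0 k

theorem convex_tikhonovSublevel (hα : 0 < α) (hq : ∀ k, 1 < q k) (c : ℝ) :
    Convex ℝ (tikhonovSublevel A y α q c) := by
  intro x hx z hz a b ha hb hab s
  have h1 := (convexOn_half_sq_norm_sub A y).2 (Set.mem_univ x) (Set.mem_univ z) ha hb hab
  have h2 : ∑ k ∈ s, |(a • x + b • z) k| ^ q k ≤
      a * ∑ k ∈ s, |x k| ^ q k + b * ∑ k ∈ s, |z k| ^ q k := by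
    rw [Finset.mul_sum, Finset.mul_sum, ← Finset.sum_add_distrib]
    exact Finset.sum_le_sum fun k _ =>
      (strictConvexOn_abs_rpow (hq k)).convexOn.2 (Set.mem_univ (x k)) (Set.mem_univ (z k))
        ha hb hab
  have h3 := mul_le_mul_of_nonneg_left (hx s) ha
  have h4 := mul_le_mul_of_nonneg_left (hz s) hb
  have h5 := mul_le_mul_of_nonneg_left h2 hα.le
  have h6 : a * c + b * c = c := by rw [← add_mul, hab, one_mul]
  simp only [smul_eq_mul] at h1
  linarith

theorem isClosed_tikhonovSublevel (hq : ∀ k, 1 < q k) (c : ℝ) :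
    IsClosed (tikhonovSublevel A y α q c) := by
  have : tikhonovSublevel A y α q c =
      ⋂ s : Finset ℕ, {x | (1 / 2) * ‖A x - y‖ ^ 2 + α * ∑ k ∈ s, |x k| ^ q k ≤ c} := by
    ext x; simp [tikhonovSublevel]
  rw [this]
  refine isClosed_iInter fun s => isClosed_le ?_ continuous_const
  have hev : ∀ k, Continuous fun x : lp (fun _ : ℕ => ℝ) 2 => x k := fun k =>
    (continuous_apply k).comp lp.uniformContinuous_coe.continuous
  refine ((continuous_const.mul (((A.continuous.sub continuous_const).norm).pow 2))).add
    (continuous_const.mul (continuous_finsetSum _ fun k _ => ?_))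
  exact (hev k).abs.rpow_const fun _ => Or.inr (by linarith [hq k])

theorem norm_le_of_forall_sum_abs_rpow_le (hq1 : ∀ k, 1 < q k) (hq2 : ∀ k, q k ≤ 2)
    {M : ℝ} (hM : 1 ≤ M) {x : lp (fun _ : ℕ => ℝ) 2}
    (h : ∀ s : Finset ℕ, ∑ k ∈ s, |x k| ^ q k ≤ M) : ‖x‖ ≤ M := by
  refine lp.norm_le_of_forall_sum_le (by norm_num) (by linarith) fun s => ?_
  have hle : ∀ k, |x k| ^ (2 : ℝ) ≤ M * |x k| ^ q k := by
    intro k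
    have hqk := hq1 k
    have h1 : |x k| ≤ M := by
      by_contra! hc
      have h2 : |x k| ^ q k ≤ M := by simpa using h {k}
      have h3 := Real.self_le_rpow_of_one_le (hM.trans hc.le) hqk.le
      linarith
    have h2 : |x k| ^ (2 : ℝ) = |x k| ^ (2 - q k) * |x k| ^ q k := by
      rw [← Real.rpow_add_of_nonneg (abs_nonneg _) (by linarith [hq2 k]) (by linarith)]
      congr 1
      ring
    rw [h2]
    gcongr
    calc |x k| ^ (2 - q k) ≤ M ^ (2 - q k) :=
          Real.rpow_le_rpow (abs_nonneg _) h1 (by linarith [hq2 k])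
      _ ≤ M ^ (1 : ℝ) := Real.rpow_le_rpow_of_exponent_le hM (by linarith)
      _ = M := Real.rpow_one M
  simp only [ENNReal.toReal_ofNat, Real.norm_eq_abs]
  calc ∑ k ∈ s, |x k| ^ (2 : ℝ) ≤ ∑ k ∈ s, M * |x k| ^ q k := Finset.sum_le_sum fun k _ => hle k
    _ = M * ∑ k ∈ s, |x k| ^ q k := by rw [Finset.mul_sum]
    _ ≤ M * M := by gcongr; exact h s
    _ = M ^ (2 : ℝ) := by rw [Real.rpow_two, sq]

theorem norm_le_of_mem_tikhonovSublevel (hα : 0 < α) (hq1 : ∀ k, 1 < q k) (hq2 : ∀ k, q k ≤ 2)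
    {c : ℝ} {x : lp (fun _ : ℕ => ℝ) 2} (hx : x ∈ tikhonovSublevel A y α q c) :
    ‖x‖ ≤ max 1 (c / α) := by
  refine norm_le_of_forall_sum_abs_rpow_le hq1 hq2 (le_max_left _ _) fun s =>
    le_trans ?_ (le_max_right _ _)
  rw [le_div_iff₀ hα]
  have := hx s
  have : 0 ≤ (1 / 2) * ‖A x - y‖ ^ 2 := by positivity
  linarith

theorem exists_tikhonov_minimizer (hα : 0 < α) (hq1 : ∀ k, 1 < q k) (hq2 : ∀ k, q k ≤ 2) :
    ∃ x₀ : lp (fun _ : ℕ => ℝ) 2, (Summable fun k => |x₀ k| ^ q k) ∧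
      ∀ x : lp (fun _ : ℕ => ℝ) 2, (Summable fun k => |x k| ^ q k) →
        tikhonov A y α q x₀ ≤ tikhonov A y α q x := by
  set V := tikhonov A y α q '' {x | Summable fun k => |x k| ^ q k} with hV
  have hVne : V.Nonempty := by
    refine ⟨_, 0, ?_, rfl⟩
    have : ∀ k, q k ≠ 0 := fun k => by linarith [hq1 k]
    simp [Real.zero_rpow (this _), summable_zero]
  have hVbdd : BddBelow V := by
    refine ⟨0, ?_⟩
    rintro _ ⟨x, -, rfl⟩
    have : 0 ≤ ∑' k, |x k| ^ q k := tsum_nonneg fun k => by positivity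
    unfold tikhonov
    positivity
  obtain ⟨x₀, hx₀⟩ := exists_forall_mem_of_antitone_convex
    (C := fun n : ℕ => tikhonovSublevel A y α q (sInf V + 1 / ((n : ℝ) + 1)))
    (fun n m h x hx s => (hx s).trans
      (add_le_add_right (one_div_le_one_div_of_le (by positivity) (by gcongr)) _))
    (fun n => by
      obtain ⟨_, ⟨x, hx, rfl⟩, hlt⟩ := exists_lt_of_csInf_lt hVne
        (lt_add_of_pos_right (sInf V) (by positivity : 0 < 1 / ((n : ℝ) + 1)))
      exact ⟨x, (mem_tikhonovSublevel_iff A y hα).2 ⟨hx, hlt.le⟩⟩)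
    (fun n => isClosed_tikhonovSublevel A y hq1 _)
    (fun n => convex_tikhonovSublevel A y hα hq1 _)
    (fun x hx => norm_le_of_mem_tikhonovSublevel A y hα hq1 hq2 hx)
  have hx₀' := fun n => (mem_tikhonovSublevel_iff A y hα).1 (hx₀ n)
  refine ⟨x₀, (hx₀' 0).1, fun x hx => ?_⟩
  have hlim := tendsto_one_div_add_atTop_nhds_zero_nat (𝕜 := ℝ).const_add (sInf V)
  rw [add_zero] at hlim
  exact (ge_of_tendsto' hlim fun n => (hx₀' n).2).trans (csInf_le hVbdd ⟨x, hx, rfl⟩)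

theorem tikhonov_minimizer_unique (hα : 0 < α) (hq1 : ∀ k, 1 < q k)
    {x z : lp (fun _ : ℕ => ℝ) 2}
    (hxs : Summable fun k => |x k| ^ q k) (hzs : Summable fun k => |z k| ^ q k)
    (hx : ∀ w : lp (fun _ : ℕ => ℝ) 2, (Summable fun k => |w k| ^ q k) →
      tikhonov A y α q x ≤ tikhonov A y α q w)
    (hz : tikhonov A y α q z ≤ tikhonov A y α q x) : z = x := by
  by_contra hne
  obtain ⟨k, hk⟩ : ∃ k, x k ≠ z k := by
    by_contra! h
    exact hne (lp.ext (funext fun k => (h k).symm))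
  set w : lp (fun _ : ℕ => ℝ) 2 := (1 / 2 : ℝ) • x + (1 / 2 : ℝ) • z
  have hle : ∀ j, |w j| ^ q j ≤ 1 / 2 * |x j| ^ q j + 1 / 2 * |z j| ^ q j := fun j =>
    (strictConvexOn_abs_rpow (hq1 j)).convexOn.2 (Set.mem_univ (x j)) (Set.mem_univ (z j))
      (by norm_num) (by norm_num) (by norm_num)
  have hlt : |w k| ^ q k < 1 / 2 * |x k| ^ q k + 1 / 2 * |z k| ^ q k :=
    (strictConvexOn_abs_rpow (hq1 k)).2 (Set.mem_univ (x k)) (Set.mem_univ (z k)) hk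
      (by norm_num) (by norm_num) (by norm_num)
  have hsum := (hxs.mul_left (1 / 2)).add (hzs.mul_left (1 / 2))
  have hws : Summable fun j => |w j| ^ q j :=
    .of_nonneg_of_le (fun j => by positivity) hle hsum
  have h1 := hws.tsum_lt_tsum hle hlt hsum
  rw [(hxs.mul_left _).tsum_add (hzs.mul_left _), tsum_mul_left, tsum_mul_left] at h1
  have h2 := (convexOn_half_sq_norm_sub A y).2 (Set.mem_univ x) (Set.mem_univ z)
    (by norm_num : (0 : ℝ) ≤ 1 / 2) (by norm_num : (0 : ℝ) ≤ 1 / 2) (by norm_num)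
  have h3 := hx w hws
  have h4 := mul_lt_mul_of_pos_left h1 hα
  unfold tikhonov at h3 hz
  simp only [smul_eq_mul] at h2
  linarith

theorem tikhonov_add_single {x : lp (fun _ : ℕ => ℝ) 2}
    (hxs : Summable fun k => |x k| ^ q k) (k : ℕ) (t : ℝ) :
    (Summable fun j => |(x + t • lp.single 2 k 1 : lp (fun _ : ℕ => ℝ) 2) j| ^ q j) ∧
      tikhonov A y α q (x + t • lp.single 2 k 1) =
        (1 / 2) * ‖A x - y + t • A (lp.single 2 k 1)‖ ^ 2 +
          α * (|x k + t| ^ q k - |x k| ^ q k + ∑' j, |x j| ^ q j) := by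
  have h : (fun j => |(x + t • lp.single 2 k 1 : lp (fun _ : ℕ => ℝ) 2) j| ^ q j) =
      Function.update (fun j => |x j| ^ q j) k (|x k + t| ^ q k) := by
    funext j
    have hj : (x + t • lp.single 2 k 1 : lp (fun _ : ℕ => ℝ) 2) j =
        x j + t * (Pi.single k 1 : ℕ → ℝ) j := rfl
    rw [hj]
    rcases eq_or_ne j k with rfl | hj
    · simp
    · simp [hj]
  have hs := hxs.hasSum.update k (|x k + t| ^ q k)
  rw [← h] at hs
  refine ⟨hs.summable, ?_⟩
  unfold tikhonov
  rw [hs.tsum_eq, map_add, map_smul, add_sub_right_comm]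

/-- First-order optimality condition for a minimizer of the Tikhonov functional. -/
theorem tikhonov_minimizer_stationary (hq1 : ∀ k, 1 < q k) {x : lp (fun _ : ℕ => ℝ) 2}
    (hxs : Summable fun k => |x k| ^ q k)
    (hx : ∀ w : lp (fun _ : ℕ => ℝ) 2, (Summable fun k => |w k| ^ q k) →
      tikhonov A y α q x ≤ tikhonov A y α q w) (k : ℕ) :
    inner ℝ (A x - y) (A (lp.single 2 k 1)) + α * (q k * |x k| ^ (q k - 2) * x k) = 0 := by
  set v := A (lp.single 2 k 1)
  set f : ℝ → ℝ := fun t => (1 / 2) * ‖A x - y + t • v‖ ^ 2 +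
    α * (|x k + t| ^ q k - |x k| ^ q k + ∑' j, |x j| ^ q j) with hf
  have hmin : IsLocalMin f 0 := Eventually.of_forall fun t => by
    obtain ⟨hs, he⟩ := tikhonov_add_single A y (α := α) hxs k t
    have h0 : f 0 = tikhonov A y α q x := by simp [hf, tikhonov]
    rw [h0]
    exact (hx _ hs).trans_eq he
  have h1 : HasDerivAt (fun t : ℝ => A x - y + t • v) v 0 := by
    simpa using ((hasDerivAt_id (0 : ℝ)).smul_const v).const_add (A x - y)
  have h2 : HasDerivAt (fun t : ℝ => |x k + t| ^ q k) (q k * |x k| ^ (q k - 2) * x k) 0 := by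
    have := (hasDerivAt_abs_rpow (x k + 0) (hq1 k)).comp_const_add (x k) 0
    simpa using this
  have h3 := (h1.norm_sq.const_mul (1 / 2)).add
    (((h2.sub_const (|x k| ^ q k)).add_const (∑' j, |x j| ^ q j)).const_mul α)
  have h4 := hmin.hasDerivAt_eq_zero h3
  simp only [zero_smul, add_zero] at h4
  linarith

theorem summable_tikhonov_minimizer [CompleteSpace Y] (hα : 0 < α) (hq1 : ∀ k, 1 < q k)
    {x : lp (fun _ : ℕ => ℝ) 2} (hxs : Summable fun k => |x k| ^ q k)
    (hx : ∀ w : lp (fun _ : ℕ => ℝ) 2, (Summable fun k => |w k| ^ q k) →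
      tikhonov A y α q x ≤ tikhonov A y α q w) :
    Summable fun k => |x k| ^ (2 * (q k - 1)) := by
  set b := ContinuousLinearMap.adjoint A (A x - y) with hb
  have hbs : Summable fun k => |b k| ^ (2 : ℝ) := by
    simpa using (lp.hasSum_norm (by norm_num) b).summable
  refine .of_nonneg_of_le (fun k => by positivity) (fun k => ?_) (hbs.mul_left (1 / α ^ 2))
  have hqk := hq1 k
  have h1 := tikhonov_minimizer_stationary A y hq1 hxs hx k
  have h2 : inner ℝ (A x - y) (A (lp.single 2 k 1)) = b k := by
    rw [← ContinuousLinearMap.adjoint_inner_left, lp.inner_single_right]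
    simp [hb]
  have h3 : |x k| ^ (q k - 2) * |x k| = |x k| ^ (q k - 1) := by
    rcases eq_or_ne (x k) 0 with h0 | h0
    · rw [h0, abs_zero, mul_zero, Real.zero_rpow (by linarith)]
    · rw [← Real.rpow_add_one (abs_pos.2 h0).ne']
      congr 1
      ring
  have h4 : α * (q k * |x k| ^ (q k - 1)) = |b k| := by
    have : b k = -(α * (q k * |x k| ^ (q k - 2) * x k)) := by linarith
    rw [this, abs_neg, abs_mul, abs_mul, abs_mul, abs_of_pos hα,
      abs_of_pos (by linarith : 0 < q k), abs_of_nonneg (by positivity : 0 ≤ |x k| ^ (q k - 2)),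
      mul_assoc (q k), h3]
  have h5 : α * |x k| ^ (q k - 1) ≤ |b k| := by
    rw [← h4]
    gcongr
    exact le_mul_of_one_le_left (by positivity) hqk.le
  have h6 : |x k| ^ (2 * (q k - 1)) = (|x k| ^ (q k - 1)) ^ 2 := by
    rw [mul_comm, Real.rpow_mul (abs_nonneg _), Real.rpow_two]
  rw [h6, Real.rpow_two, one_div, ← div_eq_inv_mul, le_div_iff₀ (by positivity), mul_comm,
    ← mul_pow]
  exact pow_le_pow_left₀ (by positivity) h5 2

end Tikhonov

/-- Let `Y` be a real Hilbert space, `A : ℓ² → Y` continuous linear,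
`y ∈ Y`, `α > 0`. If `1 < q_k ≤ 2`, `q_k → 1`, and there is `N ∈ ℕ`, `N > 1`, with
`∑_k N^{−1/(q_k−1)} < ∞` (so `ℓ^{q_k} = ℓ¹`), then the Tikhonov functional
`x ↦ ½‖Ax − y‖² + α ∑_k |x_k|^{q_k}` has a unique minimizer `x_α` over
`{x ∈ ℓ² : ∑_k |x_k|^{q_k} < ∞}`, and moreover `∑_k |(x_α)_k|^{2(q_k−1)} < ∞`. -/
theorem stmt_13
    {Y : Type*} [NormedAddCommGroup Y] [InnerProductSpace ℝ Y] [CompleteSpace Y]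
    (A : lp (fun _ : ℕ => ℝ) 2 →L[ℝ] Y) (y : Y) (α : ℝ) (hα : 0 < α)
    (q : ℕ → ℝ) (hq1 : ∀ k, 1 < q k) (hq2 : ∀ k, q k ≤ 2)
    (hqlim : Tendsto q atTop (𝓝 1))
    (hN : ∃ N : ℕ, 1 < N ∧ Summable fun k => (N : ℝ) ^ (-(1 / (q k - 1)))) :
    ∃ xα : lp (fun _ : ℕ => ℝ) 2,
      (Summable fun k => |xα k| ^ q k) ∧
      (∀ x : lp (fun _ : ℕ => ℝ) 2, (Summable fun k => |x k| ^ q k) →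
        (1 / 2) * ‖A xα - y‖ ^ 2 + α * ∑' k, |xα k| ^ q k ≤
          (1 / 2) * ‖A x - y‖ ^ 2 + α * ∑' k, |x k| ^ q k) ∧
      (∀ x' : lp (fun _ : ℕ => ℝ) 2, (Summable fun k => |x' k| ^ q k) →
        (∀ x : lp (fun _ : ℕ => ℝ) 2, (Summable fun k => |x k| ^ q k) →
          (1 / 2) * ‖A x' - y‖ ^ 2 + α * ∑' k, |x' k| ^ q k ≤
            (1 / 2) * ‖A x - y‖ ^ 2 + α * ∑' k, |x k| ^ q k) →
        x' = xα) ∧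
      (Summable fun k => |xα k| ^ (2 * (q k - 1))) := by
  obtain ⟨x₀, hs, hmin⟩ := exists_tikhonov_minimizer A y hα hq1 hq2
  exact ⟨x₀, hs, hmin,
    fun z hzs hz => tikhonov_minimizer_unique A y hα hq1 hs hzs hmin (hz x₀ hs),
    summable_tikhonov_minimizer A y hα hq1 hs hmin⟩
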